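/- Let r ≥ 2 be an integer and P an r-uniform pattern. Then for every integer s ≥ 1, λ(P+s) = (r^r · (s+r)!)/((r+s)^{r+s} · r!) · λ(P). In particular, the real numbers λ(P+s) and λ(P) have the same algebraic degree (degree of the minimal polynomial over ℚ, ∞ if transcendental). -/

import Mathlib

/-- The Lagrange polynomial of a family `E` of `r`-element multisets on `{1, …, m}`:
`λ_E(x) = r! · Σ_{S ∈ E} Π_{i=1}^m x_i^{S(i)} / S(i)!`. -/
noncomputable def lagrangePoly (r m : ℕ) (E : Finset (Multiset ℕ)) (x : ℕ → ℝ) : ℝ :=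
  (Nat.factorial r : ℝ) *
    ∑ S ∈ E, ∏ i ∈ Finset.Icc 1 m, x i ^ (S.count i) / (Nat.factorial (S.count i) : ℝ)

/-- The standard simplex `Δ_{m-1}`, viewed on the coordinates `1, …, m`. -/
def patternSimplex (m : ℕ) : Set (ℕ → ℝ) :=
  {x | (∀ i ∈ Finset.Icc 1 m, 0 ≤ x i ∧ x i ≤ 1) ∧ ∑ i ∈ Finset.Icc 1 m, x i = 1}

/-- The Lagrangian `λ(P)` of the pattern `P = (m, E)` (with uniformity `r`):
the supremum (in fact maximum) of the Lagrange polynomial over the standard simplex. -/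
noncomputable def lagrangian (r m : ℕ) (E : Finset (Multiset ℕ)) : ℝ :=
  sSup (lagrangePoly r m E '' patternSimplex m)

/-- A vector is `P`-optimal if it lies in the simplex and attains the Lagrangian. -/
def IsOptimalVec (r m : ℕ) (E : Finset (Multiset ℕ)) (x : ℕ → ℝ) : Prop :=
  x ∈ patternSimplex m ∧ lagrangePoly r m E x = lagrangian r m E

/-- A pattern is minimal if no `P`-optimal vector has a zero entry. -/
def IsMinimalPattern (r m : ℕ) (E : Finset (Multiset ℕ)) : Prop :=
  ∀ x : ℕ → ℝ, IsOptimalVec r m E x → ∀ i ∈ Finset.Icc 1 m, x i ≠ 0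

/-- The pattern `P + s`: every multiset of `E` gets the `s` new elements
`m+1, …, m+s` inserted (each with multiplicity 1). -/
def patternPlus (m s : ℕ) (E : Finset (Multiset ℕ)) : Finset (Multiset ℕ) :=
  E.image fun S => S + (Finset.Icc (m + 1) (m + s)).val

theorem Icc_one_add_eq_disjUnion (m s : ℕ) :
    Finset.Icc 1 (m + s) = (Finset.Icc 1 m).disjUnion (Finset.Icc (m + 1) (m + s))
      (Finset.disjoint_left.2 fun i hi hj => by
        simp only [Finset.mem_Icc] at hi hj; omega) := by
  ext i
  simp only [Finset.mem_Icc, Finset.mem_disjUnion]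
  omega

theorem lagrangePoly_nonneg (r m : ℕ) (E : Finset (Multiset ℕ)) {x : ℕ → ℝ}
    (hx : ∀ i ∈ Finset.Icc 1 m, 0 ≤ x i) : 0 ≤ lagrangePoly r m E x := by
  refine mul_nonneg (by positivity) (Finset.sum_nonneg fun S _ => Finset.prod_nonneg fun i hi => ?_)
  have := hx i hi
  positivity

theorem lagrangePoly_congr (r m : ℕ) (E : Finset (Multiset ℕ)) {x y : ℕ → ℝ}
    (h : ∀ i ∈ Finset.Icc 1 m, x i = y i) : lagrangePoly r m E x = lagrangePoly r m E y := by
  unfold lagrangePoly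
  congr 1
  refine Finset.sum_congr rfl fun S _ => Finset.prod_congr rfl fun i hi => ?_
  rw [h i hi]

/-- The Lagrange polynomial of an `r`-uniform pattern is homogeneous of degree `r`. -/
theorem lagrangePoly_mul {r m : ℕ} {E : Finset (Multiset ℕ)}
    (hE : ∀ S ∈ E, Multiset.card S = r ∧ ∀ i ∈ S, i ∈ Finset.Icc 1 m) (t : ℝ) (x : ℕ → ℝ) :
    lagrangePoly r m E (fun i => t * x i) = t ^ r * lagrangePoly r m E x := by
  unfold lagrangePoly
  rw [mul_left_comm, Finset.mul_sum (a := t ^ r)]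
  congr 1
  refine Finset.sum_congr rfl fun S hS => ?_
  obtain ⟨hcard, hmem⟩ := hE S hS
  rw [← hcard, ← Multiset.sum_count_eq_card hmem, ← Finset.prod_pow_eq_pow_sum,
    ← Finset.prod_mul_distrib]
  refine Finset.prod_congr rfl fun i _ => ?_
  rw [mul_pow, mul_div_assoc]

theorem lagrangePoly_patternPlus {r m : ℕ} (s : ℕ) {E : Finset (Multiset ℕ)}
    (hE : ∀ S ∈ E, ∀ i ∈ S, i ∈ Finset.Icc 1 m) (y : ℕ → ℝ) :
    lagrangePoly (r + s) (m + s) (patternPlus m s E) y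
      = ((r + s).factorial : ℝ) / (r.factorial : ℝ) * (∏ j ∈ Finset.Icc (m + 1) (m + s), y j)
        * lagrangePoly r m E y := by
  unfold lagrangePoly patternPlus
  rw [Finset.sum_image fun S _ T _ h => add_right_cancel h]
  have key : ∀ S ∈ E,
      ∏ i ∈ Finset.Icc 1 (m + s), y i ^ (S + (Finset.Icc (m + 1) (m + s)).val).count i
        / (((S + (Finset.Icc (m + 1) (m + s)).val).count i).factorial : ℝ)
      = (∏ j ∈ Finset.Icc (m + 1) (m + s), y j)
        * ∏ i ∈ Finset.Icc 1 m, y i ^ S.count i / ((S.count i).factorial : ℝ) := by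
    intro S hS
    rw [Icc_one_add_eq_disjUnion, Finset.prod_disjUnion, mul_comm]
    congr 1
    · refine Finset.prod_congr rfl fun j hj => ?_
      have hjS : j ∉ S := fun h => by
        have := hE S hS j h
        simp only [Finset.mem_Icc] at this hj
        omega
      rw [Multiset.count_add, Multiset.count_eq_zero_of_notMem hjS,
        Multiset.count_eq_one_of_mem (Finset.nodup _) hj]
      simp
    · refine Finset.prod_congr rfl fun i hi => ?_
      have hi' : i ∉ (Finset.Icc (m + 1) (m + s)).val := fun h => by
        rw [Finset.mem_val] at h
        simp only [Finset.mem_Icc] at h hi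
        omega
      rw [Multiset.count_add, Multiset.count_eq_zero_of_notMem hi', add_zero]
  rw [Finset.sum_congr rfl key, ← Finset.mul_sum]
  field_simp

theorem bddAbove_lagrangePoly (r m : ℕ) (E : Finset (Multiset ℕ)) :
    BddAbove (lagrangePoly r m E '' patternSimplex m) := by
  refine ⟨r.factorial * ∑ S ∈ E, 1, ?_⟩
  rintro _ ⟨x, hx, rfl⟩
  refine mul_le_mul_of_nonneg_left (Finset.sum_le_sum fun S _ => ?_) (by positivity)
  refine Finset.prod_le_one (fun i hi => ?_) fun i hi => ?_
  · have := (hx.1 i hi).1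
    positivity
  · have hfac : (1 : ℝ) ≤ ((S.count i).factorial : ℝ) := by
      exact_mod_cast Nat.one_le_iff_ne_zero.2 (Nat.factorial_ne_zero _)
    rw [div_le_one (by positivity)]
    exact (pow_le_one₀ (hx.1 i hi).1 (hx.1 i hi).2).trans hfac

theorem patternSimplex_nonempty {m : ℕ} (hm : 1 ≤ m) : (patternSimplex m).Nonempty := by
  refine ⟨fun i => if i = 1 then 1 else 0, fun i _ => ?_, ?_⟩
  · dsimp only
    split_ifs <;> norm_num
  · simp [hm]

theorem mem_patternSimplex_of_nonneg {m : ℕ} {x : ℕ → ℝ} (h0 : ∀ i ∈ Finset.Icc 1 m, 0 ≤ x i)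
    (h1 : ∑ i ∈ Finset.Icc 1 m, x i = 1) : x ∈ patternSimplex m :=
  ⟨fun i hi => ⟨h0 i hi, h1 ▸ Finset.single_le_sum h0 hi⟩, h1⟩

theorem lagrangePoly_le_pow_mul_lagrangian {r m : ℕ} (hr : r ≠ 0) {E : Finset (Multiset ℕ)}
    (hE : ∀ S ∈ E, Multiset.card S = r ∧ ∀ i ∈ S, i ∈ Finset.Icc 1 m) {x : ℕ → ℝ}
    (hx : ∀ i ∈ Finset.Icc 1 m, 0 ≤ x i) :
    lagrangePoly r m E x ≤ (∑ i ∈ Finset.Icc 1 m, x i) ^ r * lagrangian r m E := by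
  set a := ∑ i ∈ Finset.Icc 1 m, x i with ha
  have ha0 : 0 ≤ a := Finset.sum_nonneg hx
  rcases ha0.eq_or_lt with h | h
  · have hz : ∀ i ∈ Finset.Icc 1 m, x i = 0 * x i := fun i hi => by
      rw [(Finset.sum_eq_zero_iff_of_nonneg hx).1 (ha ▸ h.symm) i hi, mul_zero]
    rw [lagrangePoly_congr r m E hz, lagrangePoly_mul hE, ← h, zero_pow hr, zero_mul, zero_mul]
  · have hz : ∀ i ∈ Finset.Icc 1 m, x i = a * (a⁻¹ * x i) := fun i _ => by
      rw [mul_inv_cancel_left₀ h.ne']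
    rw [lagrangePoly_congr r m E hz, lagrangePoly_mul hE]
    refine mul_le_mul_of_nonneg_left (le_csSup (bddAbove_lagrangePoly r m E) ⟨_, ?_, rfl⟩)
      (by positivity)
    refine mem_patternSimplex_of_nonneg (fun i hi => ?_) ?_
    · have := hx i hi
      positivity
    · rw [← Finset.mul_sum, ← ha, inv_mul_cancel₀ h.ne']

/-- The AM-GM inequality for `r` copies of `a / r` and the numbers `y j`. -/
theorem pow_mul_prod_le_of_add_sum_eq_one {ι : Type*} {r : ℕ} (hr : r ≠ 0) (J : Finset ι) {a : ℝ}
    {y : ι → ℝ} (ha : 0 ≤ a) (hy : ∀ j ∈ J, 0 ≤ y j) (h : a + ∑ j ∈ J, y j = 1) :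
    a ^ r * ∏ j ∈ J, y j ≤ (r : ℝ) ^ r / ((r + J.card : ℕ) : ℝ) ^ (r + J.card) := by
  set n : ℝ := ((r + J.card : ℕ) : ℝ) with hn
  have hn0 : 0 < n := by positivity
  have exp_bound : ∀ z : ℝ, z ≤ Real.exp (z - 1) := fun z => by
    linarith [Real.add_one_le_exp (z - 1)]
  have h1 : (n * (a / r)) ^ r ≤ Real.exp (n * (a / r) - 1) ^ r :=
    pow_le_pow_left₀ (by positivity) (exp_bound _) r
  have h2 : ∏ j ∈ J, (n * y j) ≤ ∏ j ∈ J, Real.exp (n * y j - 1) :=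
    Finset.prod_le_prod (fun j hj => mul_nonneg hn0.le (hy j hj)) fun j _ => exp_bound _
  have h3 : (n * (a / r)) ^ r * ∏ j ∈ J, (n * y j) ≤ 1 := by
    refine (mul_le_mul h1 h2 (Finset.prod_nonneg fun j hj => mul_nonneg hn0.le (hy j hj))
      (by positivity)).trans_eq ?_
    rw [← Real.exp_nat_mul, ← Real.exp_sum, ← Real.exp_add, Real.exp_eq_one_iff,
      Finset.sum_sub_distrib, ← Finset.mul_sum, eq_sub_of_add_eq' h, Finset.sum_const,
      nsmul_eq_mul, hn]
    push_cast
    field_simp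
    ring
  rw [Finset.prod_mul_distrib, Finset.prod_const, mul_pow, div_pow] at h3
  rw [le_div_iff₀ (by positivity), pow_add]
  have h4 := mul_le_mul_of_nonneg_right h3 (by positivity : (0 : ℝ) ≤ (r : ℝ) ^ r)
  rw [one_mul] at h4
  refine le_of_eq_of_le ?_ h4
  field_simp

theorem adjoin_algebraMap_mul_simple {K L : Type*} [Field K] [Field L] [Algebra K L] {c : K}
    (hc : c ≠ 0) (x : L) :
    IntermediateField.adjoin K {algebraMap K L c * x} = IntermediateField.adjoin K {x} := by
  have hle : ∀ (d : K) (z : L),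
      IntermediateField.adjoin K {algebraMap K L d * z} ≤ IntermediateField.adjoin K {z} :=
    fun d z => IntermediateField.adjoin_simple_le_iff.2 <|
      mul_mem (IntermediateField.algebraMap_mem _ d) (IntermediateField.mem_adjoin_simple_self K z)
  refine le_antisymm (hle c x) ?_
  have := hle c⁻¹ (algebraMap K L c * x)
  rwa [← mul_assoc, ← map_mul, inv_mul_cancel₀ hc, map_one, one_mul] at this

theorem isAlgebraic_algebraMap_mul_iff {K L : Type*} [Field K] [Field L] [Algebra K L] {c : K}
    (hc : c ≠ 0) (x : L) : IsAlgebraic K (algebraMap K L c * x) ↔ IsAlgebraic K x := by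
  refine ⟨fun h => ?_, fun h => (isAlgebraic_algebraMap c).mul h⟩
  have := (isAlgebraic_algebraMap (A := L) c⁻¹).mul h
  rwa [← mul_assoc, ← map_mul, inv_mul_cancel₀ hc, map_one, one_mul] at this

theorem natDegree_minpoly_algebraMap_mul {K L : Type*} [Field K] [Field L] [Algebra K L] {c : K}
    (hc : c ≠ 0) (x : L) :
    (minpoly K (algebraMap K L c * x)).natDegree = (minpoly K x).natDegree := by
  by_cases hx : IsAlgebraic K x
  · rw [← IntermediateField.adjoin.finrank hx.isIntegral,
      ← IntermediateField.adjoin.finrank ((isAlgebraic_algebraMap_mul_iff hc x).2 hx).isIntegral,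
      adjoin_algebraMap_mul_simple hc]
  · rw [minpoly.eq_zero fun h => hx h.isAlgebraic,
      minpoly.eq_zero fun h => hx ((isAlgebraic_algebraMap_mul_iff hc x).1 h.isAlgebraic)]

/-- Scaling a point of the simplex by `r / (r + s)` and giving weight `1 / (r + s)` to each of the
`s` new coordinates yields a point of the larger simplex. -/
theorem extend_mem_patternSimplex {r m s : ℕ} (hr : r ≠ 0) {x : ℕ → ℝ}
    (hx : x ∈ patternSimplex m) :
    (fun i => if i ≤ m then (r : ℝ) / ((r + s : ℕ) : ℝ) * x i else 1 / ((r + s : ℕ) : ℝ))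
      ∈ patternSimplex (m + s) := by
  refine mem_patternSimplex_of_nonneg (fun i hi => ?_) ?_
  · split_ifs with h
    · have := (hx.1 i (Finset.mem_Icc.2 ⟨(Finset.mem_Icc.1 hi).1, h⟩)).1
      positivity
    · positivity
  · rw [Icc_one_add_eq_disjUnion, Finset.sum_disjUnion,
      Finset.sum_congr rfl fun i hi => if_pos (Finset.mem_Icc.1 hi).2,
      Finset.sum_congr (s₁ := Finset.Icc (m + 1) (m + s)) rfl fun i hi =>
        if_neg (Nat.not_le.2 (Finset.mem_Icc.1 hi).1),
      ← Finset.mul_sum, hx.2]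
    simp only [Finset.sum_const, Nat.card_Icc, nsmul_eq_mul]
    rw [show m + s + 1 - (m + 1) = s by omega]
    field_simp
    push_cast
    ring

theorem lagrangian_patternPlus_eq {r m : ℕ} (s : ℕ) (hr : r ≠ 0) (hm : 1 ≤ m)
    {E : Finset (Multiset ℕ)}
    (hE : ∀ S ∈ E, Multiset.card S = r ∧ ∀ i ∈ S, i ∈ Finset.Icc 1 m) :
    lagrangian (r + s) (m + s) (patternPlus m s E)
      = ((r : ℝ) ^ r * (Nat.factorial (s + r) : ℝ))
          / (((r + s : ℕ) : ℝ) ^ (r + s) * (Nat.factorial r : ℝ))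
        * lagrangian r m E := by
  have hfac := lagrangePoly_patternPlus (r := r) s fun S hS => (hE S hS).2
  have hcard : (Finset.Icc (m + 1) (m + s)).card = s := by simp
  rw [add_comm s r]
  apply le_antisymm
  · refine csSup_le ((patternSimplex_nonempty (by omega)).image _) ?_
    rintro _ ⟨y, hy, rfl⟩
    have hsum := hy.2
    have hlow : ∀ i ∈ Finset.Icc 1 m, 0 ≤ y i := fun i hi =>
      (hy.1 i (Finset.Icc_subset_Icc_right (by omega) hi)).1
    have hhigh : ∀ i ∈ Finset.Icc (m + 1) (m + s), 0 ≤ y i := fun i hi =>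
      (hy.1 i (Finset.Icc_subset_Icc_left (by omega) hi)).1
    rw [Icc_one_add_eq_disjUnion, Finset.sum_disjUnion] at hsum
    have hamgm := pow_mul_prod_le_of_add_sum_eq_one hr _ (Finset.sum_nonneg hlow) hhigh hsum
    rw [hcard] at hamgm
    have hL : 0 ≤ lagrangian r m E := by
      obtain ⟨x, hx⟩ := patternSimplex_nonempty hm
      exact (lagrangePoly_nonneg r m E fun i hi => (hx.1 i hi).1).trans
        (le_csSup (bddAbove_lagrangePoly r m E) ⟨x, hx, rfl⟩)
    have hP := Finset.prod_nonneg hhigh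
    rw [hfac]
    calc _ ≤ ((r + s).factorial : ℝ) / r.factorial * (∏ j ∈ Finset.Icc (m + 1) (m + s), y j)
            * ((∑ i ∈ Finset.Icc 1 m, y i) ^ r * lagrangian r m E) := by
          gcongr
          exact lagrangePoly_le_pow_mul_lagrangian hr hE hlow
      _ = ((r + s).factorial : ℝ) / r.factorial * ((∑ i ∈ Finset.Icc 1 m, y i) ^ r
            * ∏ j ∈ Finset.Icc (m + 1) (m + s), y j) * lagrangian r m E := by ring
      _ ≤ ((r + s).factorial : ℝ) / r.factorial * ((r : ℝ) ^ r / ((r + s : ℕ) : ℝ) ^ (r + s))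
            * lagrangian r m E := by gcongr
      _ = _ := by field_simp
  · rw [mul_comm, ← le_div_iff₀ (by positivity)]
    refine csSup_le ((patternSimplex_nonempty hm).image _) ?_
    rintro _ ⟨x, hx, rfl⟩
    rw [le_div_iff₀ (by positivity)]
    refine le_csSup_of_le (bddAbove_lagrangePoly _ _ _)
      ⟨_, extend_mem_patternSimplex (s := s) hr hx, rfl⟩ (le_of_eq ?_)
    rw [hfac, lagrangePoly_congr r m E fun i hi => if_pos (Finset.mem_Icc.1 hi).2,
      lagrangePoly_mul hE, Finset.prod_congr rfl fun i hi =>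
        if_neg (Nat.not_le.2 (Finset.mem_Icc.1 hi).1), Finset.prod_const, hcard, pow_add, div_pow,
      div_pow, one_pow]
    field_simp

/-- Let `r ≥ 2` and let `P = (m, E)` be an `r`-uniform pattern. Then for every `s ≥ 1`,
`λ(P+s) = (r^r · (s+r)!) / ((r+s)^{r+s} · r!) · λ(P)`; in particular `λ(P+s)` and `λ(P)`
have the same algebraic degree (both transcendental, or the minimal polynomials over `ℚ`
have equal degrees). -/
theorem lagrangian_patternPlus (r m s : ℕ) (hr : 2 ≤ r) (hm : 1 ≤ m) (hs : 1 ≤ s)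
    (E : Finset (Multiset ℕ))
    (hE : ∀ S ∈ E, Multiset.card S = r ∧ ∀ i ∈ S, i ∈ Finset.Icc 1 m) :
    lagrangian (r + s) (m + s) (patternPlus m s E)
      = ((r : ℝ) ^ r * (Nat.factorial (s + r) : ℝ))
          / (((r + s : ℕ) : ℝ) ^ (r + s) * (Nat.factorial r : ℝ))
        * lagrangian r m E ∧
    (IsAlgebraic ℚ (lagrangian (r + s) (m + s) (patternPlus m s E))
      ↔ IsAlgebraic ℚ (lagrangian r m E)) ∧
    (minpoly ℚ (lagrangian (r + s) (m + s) (patternPlus m s E))).natDegree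
      = (minpoly ℚ (lagrangian r m E)).natDegree := by
  have heq := lagrangian_patternPlus_eq s (by omega) hm hE
  set c : ℚ := ((r : ℚ) ^ r * (Nat.factorial (s + r) : ℚ))
    / (((r + s : ℕ) : ℚ) ^ (r + s) * (Nat.factorial r : ℚ)) with hc
  have hc0 : c ≠ 0 := by positivity
  have hcast : ((r : ℝ) ^ r * (Nat.factorial (s + r) : ℝ))
      / (((r + s : ℕ) : ℝ) ^ (r + s) * (Nat.factorial r : ℝ)) = algebraMap ℚ ℝ c := by
    rw [hc, eq_ratCast]
    push_cast
    rfl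
  refine ⟨heq, ?_⟩
  rw [heq, hcast]
  exact ⟨isAlgebraic_algebraMap_mul_iff hc0 _, natDegree_minpoly_algebraMap_mul hc0 _⟩
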